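/- arXiv:1402.0962 — 4 statements merged into one kernel-verified Lean document; each statement's English description precedes it below -/
import Mathlib

section
/- Let Γ be a lattice in SL_n(ℝ). Then the ℝ-linear span of Γ, regarded as a subset of the space M_n(ℝ) of n × n real matrices, is all of M_n(ℝ). -/
open MeasureTheory Matrix

/-- The subspace topology on `SL(n, ℝ)` induced from the space of `n × n` real matrices. -/
instance (n : ℕ) : TopologicalSpace (Matrix.SpecialLinearGroup (Fin n) ℝ) :=
  TopologicalSpace.induced
    (fun A : Matrix.SpecialLinearGroup (Fin n) ℝ => (A : Matrix (Fin n) (Fin n) ℝ)) inferInstance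

/-- A lattice in a topological group: a discrete subgroup such that the quotient space
carries a nonzero finite invariant regular Borel measure. -/
def Subgroup.IsLattice {G : Type*} [Group G] [TopologicalSpace G] (Γ : Subgroup G) : Prop :=
  DiscreteTopology Γ ∧
    letI : MeasurableSpace (G ⧸ Γ) := borel _
    ∃ μ : Measure (G ⧸ Γ), μ ≠ 0 ∧ IsFiniteMeasure μ ∧ μ.Regular ∧
      SMulInvariantMeasure G (G ⧸ Γ) μ


open Filter Topology in
/-- Poincaré recurrence on the quotient by a lattice, near the base point. -/
theorem lattice_recurrence {G : Type*} [Group G] [TopologicalSpace G] [IsTopologicalGroup G]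
    (Γ : Subgroup G) (hΓ : Γ.IsLattice) (u : G) (U : Set G) (hU : U ∈ 𝓝 (1 : G)) (N : ℕ) :
    ∃ m > N, ∃ g ∈ U, ∃ h ∈ U, h⁻¹ * (u ^ m * g) ∈ Γ := by
  obtain ⟨-, μ, h0, hfin, hreg, hinv⟩ := hΓ
  letI : MeasurableSpace (G ⧸ Γ) := borel _
  haveI : BorelSpace (G ⧸ Γ) := ⟨rfl⟩
  haveI : MulAction.IsMinimal G (G ⧸ Γ) := by
    refine ⟨fun x => ?_⟩
    have : MulAction.orbit G x = Set.univ := MulAction.orbit_eq_univ G x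
    rw [this]
    exact dense_univ
  obtain ⟨V, hVU, hVo, hV1⟩ := mem_nhds_iff.1 hU
  set s : Set (G ⧸ Γ) := (QuotientGroup.mk : G → G ⧸ Γ) '' V with hs
  have hso : IsOpen s := QuotientGroup.isOpenMap_coe V hVo
  have hpos : 0 < μ s := measure_isOpen_pos_of_smulInvariant_of_ne_zero G h0 hso
    ⟨_, Set.mem_image_of_mem _ hV1⟩
  have hmp : MeasurePreserving (fun x : G ⧸ Γ => u • x) μ μ := measurePreserving_smul u μ
  obtain ⟨m, hm, hne⟩ := hmp.conservative.exists_gt_measure_inter_ne_zero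
    hso.measurableSet.nullMeasurableSet hpos.ne' N
  obtain ⟨x, ⟨g, hg, rfl⟩, hx⟩ := nonempty_of_measure_ne_zero hne
  rw [Set.mem_preimage, smul_iterate] at hx
  obtain ⟨h, hh, he⟩ := hx
  exact ⟨m, hm, g, hVU hg, h, hVU hh, QuotientGroup.eq.1 he⟩

instance slTopGroup (n : ℕ) : IsTopologicalGroup (Matrix.SpecialLinearGroup (Fin n) ℝ) :=
  Matrix.SpecialLinearGroup.topologicalGroup

theorem sl_transvection_pow {n : ℕ} {i j : Fin n} (hij : i ≠ j) (m : ℕ) :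
    ((Matrix.SpecialLinearGroup.transvection hij (1 : ℝ) ^ m :
      Matrix.SpecialLinearGroup (Fin n) ℝ) : Matrix (Fin n) (Fin n) ℝ)
      = 1 + (m : ℝ) • Matrix.single i j 1 := by
  induction m with
  | zero => simp
  | succ k ih =>
    rw [pow_succ, Matrix.SpecialLinearGroup.coe_mul, ih,
      Matrix.SpecialLinearGroup.transvection_coe]
    simp only [add_mul, mul_add, smul_mul_assoc, one_mul, mul_one,
      Matrix.single_mul_single_of_ne _ _ _ _ hij.symm]
    push_cast
    module

open Filter Topology in
theorem single_mem_span_lattice {n : ℕ}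
    (Γ : Subgroup (Matrix.SpecialLinearGroup (Fin n) ℝ)) (hΓ : Γ.IsLattice)
    {i j : Fin n} (hij : i ≠ j) :
    Matrix.single i j (1 : ℝ) ∈ Submodule.span ℝ
        {X : Matrix (Fin n) (Fin n) ℝ | ∃ γ ∈ Γ, X = (γ : Matrix (Fin n) (Fin n) ℝ)} := by
  set A := Submodule.span ℝ
        {X : Matrix (Fin n) (Fin n) ℝ | ∃ γ ∈ Γ, X = (γ : Matrix (Fin n) (Fin n) ℝ)} with hA
  have hcl : IsClosed (A : Set (Matrix (Fin n) (Fin n) ℝ)) := A.closed_of_finiteDimensional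
  let S := Matrix.SpecialLinearGroup (Fin n) ℝ
  let E : Matrix (Fin n) (Fin n) ℝ := Matrix.single i j 1
  have hc : Continuous (fun g : S => (g : Matrix (Fin n) (Fin n) ℝ)) := continuous_induced_dom
  have hci : Continuous (fun g : S => ((g⁻¹ : S) : Matrix (Fin n) (Fin n) ℝ)) :=
    hc.comp continuous_inv
  let F : ℝ × S × S → Matrix (Fin n) (Fin n) ℝ := fun p =>
    p.1 • (((p.2.2⁻¹ : S) : Matrix (Fin n) (Fin n) ℝ) * (p.2.1 : Matrix (Fin n) (Fin n) ℝ))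
      + ((p.2.2⁻¹ : S) : Matrix (Fin n) (Fin n) ℝ) * E * (p.2.1 : Matrix (Fin n) (Fin n) ℝ)
  have h1 : Continuous (fun p : ℝ × S × S => (p.2.1 : Matrix (Fin n) (Fin n) ℝ)) :=
    hc.comp (continuous_fst.comp continuous_snd)
  have h2 : Continuous (fun p : ℝ × S × S => ((p.2.2⁻¹ : S) : Matrix (Fin n) (Fin n) ℝ)) :=
    hci.comp (continuous_snd.comp continuous_snd)
  have hF : Continuous F :=
    (continuous_fst.smul (h2.mul h1)).add ((h2.mul continuous_const).mul h1)
  have hF0 : F (0, 1, 1) = E := by simp [F]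
  change E ∈ (A : Set (Matrix (Fin n) (Fin n) ℝ))
  rw [← hcl.closure_eq, mem_closure_iff_nhds]
  intro O hO
  have hpre : F ⁻¹' O ∈ 𝓝 ((0 : ℝ), (1 : S), (1 : S)) :=
    hF.continuousAt.preimage_mem_nhds (by rw [hF0]; exact hO)
  rw [nhds_prod_eq, nhds_prod_eq, Filter.mem_prod_iff] at hpre
  obtain ⟨T, hT, W, hW, hTW⟩ := hpre
  obtain ⟨U₁, hU₁, U₂, hU₂, hUW⟩ := Filter.mem_prod_iff.1 hW
  have hlim : Tendsto (fun m : ℕ => ((m : ℝ))⁻¹) atTop (𝓝 0) := tendsto_inv_atTop_nhds_zero_nat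
  obtain ⟨N, hN⟩ := eventually_atTop.1 (hlim.eventually hT)
  obtain ⟨m, hm, g, hg, h, hh, hmem⟩ := lattice_recurrence Γ hΓ
    (Matrix.SpecialLinearGroup.transvection hij (1 : ℝ)) (U₁ ∩ U₂) (inter_mem hU₁ hU₂) N
  have hm0 : (m : ℝ) ≠ 0 := by
    have : 0 < m := by omega
    positivity
  refine ⟨F ((m : ℝ)⁻¹, g, h), ?_, ?_⟩
  · exact hTW ⟨hN m hm.le, hUW ⟨hg.1, hh.2⟩⟩
  · have : F ((m : ℝ)⁻¹, g, h) = (m : ℝ)⁻¹ •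
        ((h⁻¹ * (Matrix.SpecialLinearGroup.transvection hij (1 : ℝ) ^ m * g) : S) :
          Matrix (Fin n) (Fin n) ℝ) := by
      rw [Matrix.SpecialLinearGroup.coe_mul, Matrix.SpecialLinearGroup.coe_mul,
        sl_transvection_pow]
      simp only [F, E, add_mul, mul_add, one_mul, smul_add, smul_mul_assoc, mul_smul_comm,
        smul_smul, inv_mul_cancel₀ hm0, one_smul, mul_assoc]
    rw [this]
    exact A.smul_mem _ (Submodule.subset_span ⟨_, hmem, rfl⟩)

theorem span_of_lattice_in_SL (n : ℕ)
    (Γ : Subgroup (Matrix.SpecialLinearGroup (Fin n) ℝ)) (hΓ : Γ.IsLattice) :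
    Submodule.span ℝ
        {X : Matrix (Fin n) (Fin n) ℝ | ∃ γ ∈ Γ, X = (γ : Matrix (Fin n) (Fin n) ℝ)} = ⊤ := by
  have hmul : ∀ X ∈ Submodule.span ℝ
        {X : Matrix (Fin n) (Fin n) ℝ | ∃ γ ∈ Γ, X = (γ : Matrix (Fin n) (Fin n) ℝ)},
      ∀ Y ∈ Submodule.span ℝ
        {X : Matrix (Fin n) (Fin n) ℝ | ∃ γ ∈ Γ, X = (γ : Matrix (Fin n) (Fin n) ℝ)},
      X * Y ∈ Submodule.span ℝ
        {X : Matrix (Fin n) (Fin n) ℝ | ∃ γ ∈ Γ, X = (γ : Matrix (Fin n) (Fin n) ℝ)} := by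
    intro X hX Y hY
    have := Submodule.mul_mem_mul hX hY
    rw [Submodule.span_mul_span] at this
    refine Submodule.span_mono ?_ this
    rintro _ ⟨_, ⟨a, ha, rfl⟩, _, ⟨b, hb, rfl⟩, rfl⟩
    exact ⟨a * b, Γ.mul_mem ha hb, by simp⟩
  have hone : (1 : Matrix (Fin n) (Fin n) ℝ) ∈ Submodule.span ℝ
        {X : Matrix (Fin n) (Fin n) ℝ | ∃ γ ∈ Γ, X = (γ : Matrix (Fin n) (Fin n) ℝ)} :=
    Submodule.subset_span ⟨1, Γ.one_mem, by simp⟩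
  have hsingle : ∀ i j : Fin n, Matrix.single i j (1 : ℝ) ∈ Submodule.span ℝ
        {X : Matrix (Fin n) (Fin n) ℝ | ∃ γ ∈ Γ, X = (γ : Matrix (Fin n) (Fin n) ℝ)} := by
    intro i j
    by_cases hij : i = j
    · subst hij
      by_cases hk : ∃ k, k ≠ i
      · obtain ⟨k, hk⟩ := hk
        have := hmul _ (single_mem_span_lattice Γ hΓ hk.symm) _ (single_mem_span_lattice Γ hΓ hk)
        simpa using this
      · push Not at hk
        convert hone using 1
        ext a b
        rw [hk a, hk b]
        simp
    · exact single_mem_span_lattice Γ hΓ hij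
  rw [eq_top_iff]
  intro X _
  rw [Matrix.matrix_eq_sum_single X]
  refine Submodule.sum_mem _ fun i _ => Submodule.sum_mem _ fun j _ => ?_
  have : Matrix.single i j (X i j) = X i j • Matrix.single i j (1 : ℝ) := by simp
  rw [this]
  exact Submodule.smul_mem _ _ (hsingle i j)
end

section
/- For every d ≥ 1 there exists ε > 0 (any ε < 1/8 works) such that for every subgroup Δ ≤ GL_d(ℝ) which is discrete in the subspace topology, the subgroup of Δ generated by the set {a ∈ Δ : ‖a − 1‖ < ε} is nilpotent, where ‖·‖ denotes the operator norm on d × d real matrices induced by the Euclidean norm and 1 is the identity matrix. -/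
open Matrix

/-- The operator norm of a real `d × d` matrix, induced by the Euclidean norm on `ℝᵈ`. -/
noncomputable def matrixOpNorm {d : ℕ} (A : Matrix (Fin d) (Fin d) ℝ) : ℝ :=
  ‖Matrix.toEuclideanCLM (𝕜 := ℝ) A‖

open scoped commutatorElement

theorem nilp_aux {G : Type*} [Group G] (A : ℕ → Set G) (S : Set G)
    (hS : Subgroup.closure S = ⊤)
    (h : ∀ i, ∀ a ∈ S, ∀ b ∈ A i, ⁅b, a⁆ ∈ A (i+1)) (N : ℕ) (hN : A N ⊆ {1}) :
    S ⊆ A 0 → Group.IsNilpotent G := by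
  intro h0
  have key : ∀ j i, i + j = N → A i ⊆ Subgroup.upperCentralSeries G j := by
    intro j
    induction j with
    | zero =>
      intro i hi b hb
      have : i = N := by omega
      subst this
      have := hN hb
      simpa using this
    | succ j ih =>
      intro i hi b hb
      have h1 := ih (i+1) (by omega)
      change b ∈ Subgroup.upperCentralSeries G (j+1)
      rw [Subgroup.mem_upperCentralSeries_succ_iff]
      intro y
      have hy : y ∈ Subgroup.closure S := by rw [hS]; trivial
      let Z := Subgroup.upperCentralSeries G j
      have hle : Subgroup.closure S ≤
          (Subgroup.centralizer {(QuotientGroup.mk' Z b)}).comap (QuotientGroup.mk' Z) := by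
        rw [Subgroup.closure_le]
        intro a ha
        have h2 : ⁅b, a⁆ ∈ Z := h1 (h i a ha b hb)
        rw [← QuotientGroup.eq_one_iff (N := Z)] at h2
        change (QuotientGroup.mk' Z) ⁅b, a⁆ = 1 at h2
        rw [map_commutatorElement, commutatorElement_eq_one_iff_mul_comm] at h2
        simp only [SetLike.mem_coe, Subgroup.mem_comap, Subgroup.mem_centralizer_singleton_iff]
        first | exact h2 | exact h2.symm
      have h3 := hle hy
      simp only [Subgroup.mem_comap, Subgroup.mem_centralizer_singleton_iff] at h3
      change ⁅b, y⁆ ∈ Z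
      rw [← QuotientGroup.eq_one_iff (N := Z)]
      change (QuotientGroup.mk' Z) ⁅b, y⁆ = 1
      rw [map_commutatorElement, commutatorElement_eq_one_iff_mul_comm]
      first | exact h3 | exact h3.symm
  have hZ := key N 0 (by omega)
  refine ⟨N, ?_⟩
  rw [eq_top_iff, ← hS, Subgroup.closure_le]
  exact h0.trans hZ

open scoped Matrix.Norms.L2Operator in
theorem comm_bound {d : ℕ} (a b : Matrix.GeneralLinearGroup (Fin d) ℝ)
    (ha : ‖(a : Matrix (Fin d) (Fin d) ℝ) - 1‖ < 1 / 16)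
    (hb : ‖(b : Matrix (Fin d) (Fin d) ℝ) - 1‖ < 1 / 16) :
    ‖((⁅b, a⁆ : Matrix.GeneralLinearGroup (Fin d) ℝ) : Matrix (Fin d) (Fin d) ℝ) - 1‖
      ≤ 1 / 2 * ‖(b : Matrix (Fin d) (Fin d) ℝ) - 1‖ := by
  have hone : ‖(1 : Matrix (Fin d) (Fin d) ℝ)‖ ≤ 1 := by
    rw [Matrix.l2_opNorm_def]
    refine ContinuousLinearMap.opNorm_le_bound _ zero_le_one fun x => ?_
    simp
  have inv : ∀ c : Matrix.GeneralLinearGroup (Fin d) ℝ,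
      ‖(c : Matrix (Fin d) (Fin d) ℝ) - 1‖ < 1 / 16 →
      ‖((c⁻¹ : Matrix.GeneralLinearGroup (Fin d) ℝ) : Matrix (Fin d) (Fin d) ℝ)‖ ≤ 2 := by
    intro c hc
    set x := ((c⁻¹ : Matrix.GeneralLinearGroup (Fin d) ℝ) : Matrix (Fin d) (Fin d) ℝ) with hx
    have e : x = 1 - ((c : Matrix (Fin d) (Fin d) ℝ) - 1) * x := by
      rw [sub_mul, hx, Units.mul_inv]; simp
    have h1 : ‖x‖ ≤ 1 + 1/16 * ‖x‖ := by
      calc ‖x‖ = ‖1 - ((c : Matrix (Fin d) (Fin d) ℝ) - 1) * x‖ := by rw [← e]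
        _ ≤ ‖(1 : Matrix (Fin d) (Fin d) ℝ)‖ + ‖((c : Matrix (Fin d) (Fin d) ℝ) - 1) * x‖ :=
          norm_sub_le _ _
        _ ≤ 1 + ‖(c : Matrix (Fin d) (Fin d) ℝ) - 1‖ * ‖x‖ := add_le_add hone (norm_mul_le _ _)
        _ ≤ _ := by gcongr
    linarith
  have ia := inv a ha
  have ib := inv b hb
  have e : ((⁅b, a⁆ : Matrix.GeneralLinearGroup (Fin d) ℝ) : Matrix (Fin d) (Fin d) ℝ) - 1
      = (((b : Matrix (Fin d) (Fin d) ℝ) - 1) * ((a : Matrix (Fin d) (Fin d) ℝ) - 1)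
        - ((a : Matrix (Fin d) (Fin d) ℝ) - 1) * ((b : Matrix (Fin d) (Fin d) ℝ) - 1))
        * (((b⁻¹ : Matrix.GeneralLinearGroup (Fin d) ℝ) : Matrix (Fin d) (Fin d) ℝ)
        * ((a⁻¹ : Matrix.GeneralLinearGroup (Fin d) ℝ) : Matrix (Fin d) (Fin d) ℝ)) := by
    have e1 : (((b : Matrix (Fin d) (Fin d) ℝ) - 1) * ((a : Matrix (Fin d) (Fin d) ℝ) - 1)
        - ((a : Matrix (Fin d) (Fin d) ℝ) - 1) * ((b : Matrix (Fin d) (Fin d) ℝ) - 1))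
        = (b : Matrix (Fin d) (Fin d) ℝ) * a - a * b := by noncomm_ring
    rw [e1, sub_mul, commutatorElement_def]
    simp only [← Units.val_mul]
    have e2 : a * b * (b⁻¹ * a⁻¹) = 1 := by group
    rw [e2, mul_assoc (b * a)]
    rfl
  rw [e]
  set u := (a : Matrix (Fin d) (Fin d) ℝ) - 1
  set v := (b : Matrix (Fin d) (Fin d) ℝ) - 1
  have n1 : ‖v * u - u * v‖ ≤ 1 / 8 * ‖v‖ := by
    have := norm_sub_le (v * u) (u * v)
    have h2 := norm_mul_le v u
    have h3 := norm_mul_le u v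
    have h4 : ‖u‖ * ‖v‖ ≤ 1 / 16 * ‖v‖ := by gcongr
    linarith
  refine (norm_mul_le _ _).trans ?_
  have n2 := (norm_mul_le ((b⁻¹ : Matrix.GeneralLinearGroup (Fin d) ℝ) : Matrix (Fin d) (Fin d) ℝ)
    ((a⁻¹ : Matrix.GeneralLinearGroup (Fin d) ℝ) : Matrix (Fin d) (Fin d) ℝ)).trans
      (mul_le_mul ib ia (norm_nonneg _) zero_le_two)
  calc _ ≤ (1 / 8 * ‖v‖) * (2 * 2) := mul_le_mul n1 n2 (norm_nonneg _) (by positivity)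
    _ = _ := by ring

open scoped Matrix.Norms.L2Operator in
theorem disc_aux {d : ℕ} (Δ : Subgroup (Matrix.GeneralLinearGroup (Fin d) ℝ))
    (hΔ : DiscreteTopology Δ) :
    ∃ δ > (0 : ℝ), ∀ a ∈ Δ, ‖(a : Matrix (Fin d) (Fin d) ℝ) - 1‖ < δ → a = 1 := by
  have : CompleteSpace (Matrix (Fin d) (Fin d) ℝ) := FiniteDimensional.complete ℝ _
  have ho : IsOpen ({1} : Set Δ) := isOpen_discrete _
  have he : Topology.IsInducing
      (fun a : Δ => ((a : Matrix.GeneralLinearGroup (Fin d) ℝ) : Matrix (Fin d) (Fin d) ℝ)) :=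
    (Units.isOpenEmbedding_val (R := Matrix (Fin d) (Fin d) ℝ)).isInducing.comp
      Topology.IsInducing.subtypeVal
  obtain ⟨U, hU, hU1⟩ := he.isOpen_iff.1 ho
  have h1 : (1 : Matrix (Fin d) (Fin d) ℝ) ∈ U := by
    have : (1 : Δ) ∈ ({1} : Set Δ) := rfl
    rw [← hU1] at this
    simpa using this
  obtain ⟨δ, hδ, hb⟩ := Metric.isOpen_iff.1 hU 1 h1
  refine ⟨δ, hδ, fun a ha h => ?_⟩
  have : (⟨a, ha⟩ : Δ) ∈ ({1} : Set Δ) := by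
    rw [← hU1]
    apply hb
    rw [Metric.mem_ball, dist_eq_norm]
    exact h
  exact congrArg Subtype.val this

open scoped Matrix.Norms.L2Operator in
theorem zassenhaus_aux {d : ℕ} (Δ : Subgroup (Matrix.GeneralLinearGroup (Fin d) ℝ))
    (hΔ : DiscreteTopology Δ) :
    Group.IsNilpotent
          (Subgroup.closure
            {a : Matrix.GeneralLinearGroup (Fin d) ℝ |
              a ∈ Δ ∧ ‖(a : Matrix (Fin d) (Fin d) ℝ) - 1‖ < 1 / 16}) := by
  set S := {a : Matrix.GeneralLinearGroup (Fin d) ℝ |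
              a ∈ Δ ∧ ‖(a : Matrix (Fin d) (Fin d) ℝ) - 1‖ < 1 / 16} with hS
  have hle : Subgroup.closure S ≤ Δ := by
    rw [Subgroup.closure_le]; exact fun a ha => ha.1
  obtain ⟨δ, hδ, h⟩ := disc_aux Δ hΔ
  obtain ⟨N, hN⟩ := exists_pow_lt_of_lt_one hδ (by norm_num : (1 / 2 : ℝ) < 1)
  refine nilp_aux (G := Subgroup.closure S)
    (fun i => {g | ‖((g : Matrix.GeneralLinearGroup (Fin d) ℝ) : Matrix (Fin d) (Fin d) ℝ) - 1‖
      < 1 / 16 * (1 / 2) ^ i})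
    (((↑) : Subgroup.closure S → Matrix.GeneralLinearGroup (Fin d) ℝ) ⁻¹' S)
    Subgroup.closure_closure_coe_preimage ?_ N ?_ ?_
  · intro i a ha b hb
    have hb' := hb
    rw [Set.mem_ofPred_eq] at hb'
    have hp : (1 / 2 : ℝ) ^ i ≤ 1 := pow_le_one₀ (by norm_num) (by norm_num)
    have := comm_bound a.1 b.1 ha.2 (by linarith)
    refine lt_of_le_of_lt this ?_
    rw [pow_succ]
    linarith
  · intro g hg
    have hg' := hg
    rw [Set.mem_ofPred_eq] at hg'
    have hp : 0 < (1 / 2 : ℝ) ^ N := by positivity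
    exact Subtype.ext (h g.1 (hle g.2) (by linarith))
  · intro a ha
    have := ha.2
    simpa using this

theorem zassenhaus_neighborhood (d : ℕ) (hd : 1 ≤ d) :
    ∃ ε > (0 : ℝ), ε < 1 / 8 ∧
      ∀ Δ : Subgroup (Matrix.GeneralLinearGroup (Fin d) ℝ), DiscreteTopology Δ →
        Group.IsNilpotent
          (Subgroup.closure
            {a : Matrix.GeneralLinearGroup (Fin d) ℝ |
              a ∈ Δ ∧ matrixOpNorm ((a : Matrix (Fin d) (Fin d) ℝ) - 1) < ε}) := by
  refine ⟨1 / 16, by norm_num, by norm_num, fun Δ hΔ => ?_⟩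
  exact zassenhaus_aux Δ hΔ
end

section
/- Let S² denote the unit sphere {x ∈ ℝ³ : ‖x‖ = 1} with the metric induced from the Euclidean metric of ℝ³. Then S² cannot be approximated by finite homogeneous metric spaces: there exists ε > 0 such that every nonempty finite metric space F whose isometry group acts transitively on F satisfies d_GH(S², F) ≥ ε, where d_GH denotes the Gromov–Hausdorff distance. -/
open Metric

/-- The round two-sphere: the unit sphere in Euclidean `ℝ³`. -/
abbrev twoSphere : Type := Metric.sphere (0 : EuclideanSpace ℝ (Fin 3)) 1

instance : Nonempty twoSphere :=
  (NormedSpace.sphere_nonempty.mpr zero_le_one).to_subtype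

abbrev E3 : Type := EuclideanSpace ℝ (Fin 3)

/-- displacement of a linear isometry -/
noncomputable def disp (A : E3 ≃ₗᵢ[ℝ] E3) : ℝ :=
  ‖(A.toContinuousLinearEquiv : E3 →L[ℝ] E3) - 1‖

lemma disp_apply (A : E3 ≃ₗᵢ[ℝ] E3) (v : E3) : ‖A v - v‖ ≤ disp A * ‖v‖ := by
  have := ((A.toContinuousLinearEquiv : E3 →L[ℝ] E3) - 1).le_opNorm v
  simpa [disp] using this

lemma disp_le (A : E3 ≃ₗᵢ[ℝ] E3) (c : ℝ) (hc : 0 ≤ c) (h : ∀ v, ‖A v - v‖ ≤ c * ‖v‖) :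
    disp A ≤ c := by
  refine ContinuousLinearMap.opNorm_le_bound _ hc ?_
  intro v
  simpa using h v

lemma disp_nonneg (A : E3 ≃ₗᵢ[ℝ] E3) : 0 ≤ disp A := norm_nonneg _

lemma disp_pos (A : E3 ≃ₗᵢ[ℝ] E3) (h : A ≠ 1) : 0 < disp A := by
  rcases (disp_nonneg A).eq_or_lt with h0 | h0
  · exfalso
    apply h
    ext1 v
    have := disp_apply A v
    rw [← h0, zero_mul] at this
    have h2 := norm_le_zero_iff.mp this
    exact sub_eq_zero.mp h2
  · exact h0

lemma disp_conj (A B : E3 ≃ₗᵢ[ℝ] E3) : disp (B * A * B⁻¹) ≤ disp A := by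
  refine disp_le _ _ (disp_nonneg A) ?_
  intro v
  have h1 : (B * A * B⁻¹) v - v = B (A (B⁻¹ v) - B⁻¹ v) := by
    rw [map_sub]
    congr 1
    exact (B.apply_symm_apply v).symm
  rw [h1, LinearIsometryEquiv.norm_map]
  refine (disp_apply A _).trans ?_
  rw [LinearIsometryEquiv.norm_map]

lemma disp_comm (A B : E3 ≃ₗᵢ[ℝ] E3) : disp (A * B * A⁻¹ * B⁻¹) ≤ 2 * disp A * disp B := by
  refine disp_le _ _ (mul_nonneg (mul_nonneg zero_le_two (disp_nonneg A)) (disp_nonneg B)) ?_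
  intro v
  set w : E3 := A⁻¹ (B⁻¹ v) with hw
  have hv : v = B (A w) := by
    have h1 : A w = B⁻¹ v := A.apply_symm_apply _
    rw [h1]
    exact (B.apply_symm_apply v).symm
  have hn : ‖v‖ = ‖w‖ := by rw [hv]; simp
  have h1 : (A * B * A⁻¹ * B⁻¹) v - v = (A (B w - w) - (B w - w)) - (B (A w - w) - (A w - w)) := by
    have : (A * B * A⁻¹ * B⁻¹) v = A (B w) := rfl
    rw [this, map_sub, map_sub, ← hv]
    abel
  rw [h1, hn]
  have a1 := disp_apply A (B w - w)
  have a2 := disp_apply B (A w - w)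
  have b1 := disp_apply A w
  have b2 := disp_apply B w
  have c1 := mul_le_mul_of_nonneg_left b2 (disp_nonneg A)
  have c2 := mul_le_mul_of_nonneg_left b1 (disp_nonneg B)
  have := norm_sub_le (A (B w - w) - (B w - w)) (B (A w - w) - (A w - w))
  nlinarith

lemma eq_of_parallel (A : E3 ≃ₗᵢ[ℝ] E3) (hA : disp A < 1/2) (v : E3) (t : ℝ) (h : A v = t • v) :
    A v = v := by
  by_cases hv : v = 0
  · subst hv; simp
  have hv' : 0 < ‖v‖ := norm_pos_iff.mpr hv
  have h1 : ‖v‖ = |t| * ‖v‖ := by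
    conv_lhs => rw [← A.norm_map v, h, norm_smul, Real.norm_eq_abs]
  have h2 : |t| = 1 := by
    have : (|t| - 1) * ‖v‖ = 0 := by linarith
    rcases mul_eq_zero.mp this with h3 | h3
    · linarith
    · exact absurd h3 hv'.ne'
  rcases eq_or_eq_neg_of_abs_eq h2 with h3 | h3
  · rw [h, h3, one_smul]
  · exfalso
    have h4 := disp_apply A v
    rw [h, h3] at h4
    have h5 : (-1 : ℝ) • v - v = (-2 : ℝ) • v := by module
    rw [h5, norm_smul] at h4
    norm_num at h4
    nlinarith

lemma exists_fixed (A : E3 ≃ₗᵢ[ℝ] E3) (hA : disp A < 1/2) : ∃ a : E3, a ≠ 0 ∧ A a = a := by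
  -- the skew map `A - A⁻¹` has a kernel
  set S : E3 →ₗ[ℝ] E3 := (A.toLinearEquiv : E3 →ₗ[ℝ] E3) - (A.symm.toLinearEquiv : E3 →ₗ[ℝ] E3)
    with hS
  have hadj : LinearMap.adjoint S = -S := by
    symm
    rw [LinearMap.eq_adjoint_iff]
    intro x y
    have e1 : inner ℝ (A x) y = inner ℝ x (A.symm y) := by
      rw [← A.inner_map_map x (A.symm y), A.apply_symm_apply]
    have e2 : inner ℝ (A.symm x) y = inner ℝ x (A y) := by
      rw [← A.inner_map_map (A.symm x) y, A.apply_symm_apply]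
    simp [hS, inner_sub_left, inner_sub_right, e1, e2]
  have hdet : LinearMap.det S = 0 := by
    let b := EuclideanSpace.basisFun (Fin 3) ℝ
    have h1 : LinearMap.det (LinearMap.adjoint S) = LinearMap.det S := by
      rw [← LinearMap.det_toMatrix b.toBasis, ← LinearMap.det_toMatrix b.toBasis S,
        LinearMap.toMatrix_adjoint b b, Matrix.det_conjTranspose]
      simp
    rw [hadj] at h1
    have h2 : -S = (-1 : ℝ) • S := by module
    rw [h2, LinearMap.det_smul] at h1
    simp only [finrank_euclideanSpace, Fintype.card_fin] at h1
    linarith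
  obtain ⟨b, hb, hb0⟩ := (Submodule.ne_bot_iff _).mp (LinearMap.bot_lt_ker_of_det_eq_zero hdet).ne'
  have hb1 : A b = A.symm b := by
    have : S b = 0 := hb
    exact sub_eq_zero.mp this
  have hb2 : A (A b) = b := by rw [hb1, A.apply_symm_apply]
  refine ⟨A b + b, ?_, ?_⟩
  · intro h
    have h1 : A b = (-1 : ℝ) • b := by rw [neg_one_smul]; exact eq_neg_of_add_eq_zero_left h
    have h2 := eq_of_parallel A hA b _ h1
    rw [h2] at h
    have : (2 : ℝ) • b = 0 := by rw [two_smul]; exact h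
    rcases smul_eq_zero.mp this with h3 | h3
    · norm_num at h3
    · exact hb0 h3
  · rw [map_add, hb2, add_comm]

lemma fixed_line (A : E3 ≃ₗᵢ[ℝ] E3) (hA : disp A < 1/2) (hA1 : A ≠ 1) (a : E3) (ha : a ≠ 0)
    (hfix : A a = a) (b : E3) (hb : A b = b) : ∃ t : ℝ, b = t • a := by
  set K : Submodule ℝ E3 := LinearMap.ker ((A.toLinearEquiv : E3 →ₗ[ℝ] E3) - 1) with hK
  have memK : ∀ x, x ∈ K ↔ A x = x := by
    intro x
    rw [hK, LinearMap.mem_ker, LinearMap.sub_apply, sub_eq_zero]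
    rfl
  have hle : Module.finrank ℝ K ≤ 1 := by
    by_contra hcon
    have hsum := K.finrank_add_finrank_orthogonal
    rw [finrank_euclideanSpace, Fintype.card_fin] at hsum
    have h1 : Module.finrank ℝ Kᗮ ≤ 1 := by omega
    obtain ⟨c, hc⟩ := finrank_le_one_iff.mp h1
    have hinv : A (c : E3) ∈ Kᗮ := by
      rw [Submodule.mem_orthogonal]
      intro u hu
      rw [← (memK u).mp hu, A.inner_map_map]
      exact (Submodule.mem_orthogonal _ _).mp c.2 u hu
    obtain ⟨t, ht⟩ := hc ⟨_, hinv⟩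
    have ht' : A (c : E3) = t • (c : E3) := by
      have := congrArg Subtype.val ht
      exact this.symm
    have hcK : (c : E3) ∈ K := (memK _).mpr (eq_of_parallel A hA _ t ht')
    have hc0 : (c : E3) = 0 := by
      have := (Submodule.mem_orthogonal _ _).mp c.2 _ hcK
      exact inner_self_eq_zero.mp this
    have hbot : Kᗮ = ⊥ := by
      rw [eq_bot_iff]
      intro x hx
      obtain ⟨s, hs⟩ := hc ⟨x, hx⟩
      have := congrArg Subtype.val hs
      simp only [Submodule.coe_smul, hc0, smul_zero] at this
      simp [← this]
    have htop : K = ⊤ := (Submodule.orthogonal_eq_bot_iff).mp hbot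
    apply hA1
    ext1 v
    have : v ∈ K := by rw [htop]; trivial
    exact (memK v).mp this
  obtain ⟨c, hc⟩ := finrank_le_one_iff.mp hle
  obtain ⟨s, hs⟩ := hc ⟨a, (memK a).mpr hfix⟩
  obtain ⟨r, hr⟩ := hc ⟨b, (memK b).mpr hb⟩
  have hs' : s • (c : E3) = a := congrArg Subtype.val hs
  have hr' : r • (c : E3) = b := congrArg Subtype.val hr
  have hs0 : s ≠ 0 := by
    rintro rfl
    apply ha
    rw [← hs', zero_smul]
  refine ⟨r / s, ?_⟩
  rw [← hr', ← hs', smul_smul, div_mul_cancel₀ _ hs0]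

lemma invariant_line (Γ : Subgroup (E3 ≃ₗᵢ[ℝ] E3)) [Finite Γ]
    (h : ∃ A ∈ Γ, A ≠ 1 ∧ disp A < 1/2) :
    ∃ a : E3, a ≠ 0 ∧ ∀ B ∈ Γ, ∃ t : ℝ, B a = t • a := by
  have hfin : Set.Finite {A : E3 ≃ₗᵢ[ℝ] E3 | A ∈ Γ ∧ A ≠ 1 ∧ disp A < 1/2} :=
    (Set.toFinite (Γ : Set (E3 ≃ₗᵢ[ℝ] E3))).subset fun A hA => hA.1
  obtain ⟨A, ⟨hAΓ, hA1, hA2⟩, hmin⟩ := Set.exists_min_image _ disp hfin h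
  have hcomm : ∀ B ∈ Γ, disp B < 1/2 → A * B = B * A := by
    intro B hB hB2
    by_contra hne
    have h1 : A * B * A⁻¹ * B⁻¹ ≠ 1 := by
      intro h1
      apply hne
      have : A * B = (A * B * A⁻¹ * B⁻¹) * (B * A) := by group
      rw [this, h1, one_mul]
    have h2 := disp_comm A B
    have h3 := disp_pos A hA1
    have h4 : disp (A * B * A⁻¹ * B⁻¹) < disp A := by nlinarith
    have h5 := hmin (A * B * A⁻¹ * B⁻¹) ⟨by
      exact Γ.mul_mem (Γ.mul_mem (Γ.mul_mem hAΓ hB) (Γ.inv_mem hAΓ)) (Γ.inv_mem hB), h1,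
      h4.trans hA2⟩
    linarith
  obtain ⟨a, ha0, ha⟩ := exists_fixed A hA2
  refine ⟨a, ha0, ?_⟩
  intro B hB
  have hC := hcomm (B * A * B⁻¹) (Γ.mul_mem (Γ.mul_mem hB hAΓ) (Γ.inv_mem hB))
    ((disp_conj A B).trans_lt hA2)
  have hCB : (B * A * B⁻¹) (B a) = B a := by
    change B (A (B.symm (B a))) = B a
    rw [B.symm_apply_apply, ha]
  -- A (B a) is fixed by the conjugate
  have h1 : B (A (B.symm (A (B a)))) = A (B a) := by
    have := congrArg (fun T : E3 ≃ₗᵢ[ℝ] E3 => T (B a)) hC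
    change A ((B * A * B⁻¹) (B a)) = B (A (B.symm (A (B a)))) at this
    rw [hCB] at this
    exact this.symm
  have h2 : A (B.symm (A (B a))) = B.symm (A (B a)) := by
    apply B.injective
    rw [h1, B.apply_symm_apply]
  obtain ⟨t, ht⟩ := fixed_line A hA2 hA1 a ha0 ha _ h2
  have h3 : A (B a) = t • B a := by
    rw [← B.apply_symm_apply (A (B a)), ht, map_smul]
  exact fixed_line A hA2 hA1 a ha0 ha _ (eq_of_parallel A hA2 _ _ h3)

lemma jordan_bound : ∃ N : ℕ, ∀ (Γ : Subgroup (E3 ≃ₗᵢ[ℝ] E3)) [Finite Γ],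
    Nat.card Γ ≤ N ∨ ∃ a : E3, a ≠ 0 ∧ ∀ B ∈ Γ, ∃ t : ℝ, B a = t • a := by
  have hc : IsCompact (Metric.closedBall (0 : E3 →L[ℝ] E3) 1) := isCompact_closedBall _ _
  obtain ⟨t, -, htf, ht⟩ := hc.finite_cover_balls (e := 1/4) (by norm_num)
  refine ⟨Nat.card t, ?_⟩
  intro Γ _
  by_cases h : ∃ A ∈ Γ, A ≠ 1 ∧ disp A < 1/2
  · exact Or.inr (invariant_line Γ h)
  left
  push Not at h
  have hcov : ∀ A : Γ, ∃ c : t, dist ((A : E3 ≃ₗᵢ[ℝ] E3).toContinuousLinearEquiv : E3 →L[ℝ] E3)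
      (c : E3 →L[ℝ] E3) < 1/4 := by
    intro A
    have h1 : ((A : E3 ≃ₗᵢ[ℝ] E3).toContinuousLinearEquiv : E3 →L[ℝ] E3) ∈
        Metric.closedBall (0 : E3 →L[ℝ] E3) 1 := by
      rw [mem_closedBall_zero_iff]
      refine ContinuousLinearMap.opNorm_le_bound _ zero_le_one ?_
      intro v
      simp
    have h2 := ht h1
    simp only [Set.mem_iUnion, Metric.mem_ball, exists_prop] at h2
    obtain ⟨c, hc, hd⟩ := h2
    exact ⟨⟨c, hc⟩, hd⟩
  choose φ hφ using hcov
  have : Finite t := htf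
  refine Nat.card_le_card_of_injective φ ?_
  intro A B hAB
  have h1 : dist ((A : E3 ≃ₗᵢ[ℝ] E3).toContinuousLinearEquiv : E3 →L[ℝ] E3)
      ((B : E3 ≃ₗᵢ[ℝ] E3).toContinuousLinearEquiv : E3 →L[ℝ] E3) < 1/2 := by
    have a1 := hφ A
    have a2 := hφ B
    rw [← hAB] at a2
    have := dist_triangle_right ((A : E3 ≃ₗᵢ[ℝ] E3).toContinuousLinearEquiv : E3 →L[ℝ] E3)
      ((B : E3 ≃ₗᵢ[ℝ] E3).toContinuousLinearEquiv : E3 →L[ℝ] E3) (φ A)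
    linarith
  have h2 : disp ((A : E3 ≃ₗᵢ[ℝ] E3)⁻¹ * B) < 1/2 := by
    refine lt_of_le_of_lt ?_ h1
    refine disp_le _ _ dist_nonneg ?_
    intro v
    have e1 : ((A : E3 ≃ₗᵢ[ℝ] E3)⁻¹ * B) v - v
        = (A : E3 ≃ₗᵢ[ℝ] E3).symm ((B : E3 ≃ₗᵢ[ℝ] E3) v - (A : E3 ≃ₗᵢ[ℝ] E3) v) := by
      rw [map_sub, LinearIsometryEquiv.symm_apply_apply]
      rfl
    rw [e1, LinearIsometryEquiv.norm_map, dist_eq_norm, norm_sub_rev]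
    exact (((A : E3 ≃ₗᵢ[ℝ] E3).toContinuousLinearEquiv : E3 →L[ℝ] E3) -
      ((B : E3 ≃ₗᵢ[ℝ] E3).toContinuousLinearEquiv : E3 →L[ℝ] E3)).le_opNorm v
  have h3 : (A : E3 ≃ₗᵢ[ℝ] E3)⁻¹ * B = 1 := by
    by_contra hne
    have := h _ (Γ.mul_mem (Γ.inv_mem A.2) B.2) hne
    linarith
  exact Subtype.ext (inv_mul_eq_one.mp h3)

section Spectral
variable {F : Type} [Fintype F]

lemma top_eigen [Nonempty F] (k : F → F → ℝ) (hk : ∀ x y, k x y = k y x) (f : F → E3)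
    (hf : ∀ x, ‖f x‖ = 1) (δ : ℝ) (hδ : δ < 1/12)
    (hkf : ∀ x y, |k x y - inner ℝ (f x) (f y)| ≤ δ) :
    ∃ Λ : ℝ, (Fintype.card F : ℝ) / 4 ≤ Λ ∧ ∃ u : EuclideanSpace ℝ F, u ≠ 0 ∧
      ∀ x, ∑ y, k x y * u y = Λ * u x := by
  classical
  set n : ℝ := (Fintype.card F : ℝ) with hn
  have hnpos : 0 < n := by rw [hn]; exact_mod_cast Fintype.card_pos
  let M : Matrix F F ℝ := Matrix.of k
  have hM : M.IsHermitian := by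
    ext x y
    simp [M, hk x y]
  have hT : (Matrix.toEuclideanLin M).IsSymmetric := Matrix.isSymmetric_toEuclideanLin_iff.mpr hM
  have hTa : ∀ (u : EuclideanSpace ℝ F) x, (Matrix.toEuclideanLin M u) x = ∑ y, k x y * u y := by
    intro u x
    simp [Matrix.toEuclideanLin, Matrix.mulVec, dotProduct, M]
  by_contra hcon
  push Not at hcon
  -- all eigenvalues are small
  let b := hT.eigenvectorBasis rfl
  have hev : ∀ i, hT.eigenvalues rfl i < n / 4 := by
    intro i
    by_contra hi
    push Not at hi
    obtain ⟨x, hx⟩ := hcon _ hi (b i) (b.orthonormal.ne_zero i)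
    apply hx
    rw [← hTa]
    have := hT.apply_eigenvectorBasis rfl i
    change Matrix.toEuclideanLin M (b i) = _ at this
    rw [this]
    simp [b]
  have hray : ∀ u : EuclideanSpace ℝ F, inner ℝ u (Matrix.toEuclideanLin M u) ≤ n / 4 * ‖u‖^2 := by
    intro u
    rw [← b.sum_inner_mul_inner, ← b.sum_sq_norm_inner_right, Finset.mul_sum]
    refine Finset.sum_le_sum ?_
    intro i _
    have h1 : inner ℝ (b i) (Matrix.toEuclideanLin M u) = hT.eigenvalues rfl i * inner ℝ (b i) u := by
      rw [← hT (b i) u, hT.apply_eigenvectorBasis rfl i, inner_smul_left]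
      simp [b]
    rw [h1, real_inner_comm, Real.norm_eq_abs, sq_abs]
    nlinarith [hev i, sq_nonneg (inner ℝ (b i) u : ℝ)]
  -- choose a coordinate
  have hsum : ∑ i : Fin 3, ∑ x, (f x i)^2 = n := by
    rw [Finset.sum_comm]
    have : ∀ x, ∑ i : Fin 3, (f x i)^2 = 1 := by
      intro x
      rw [← EuclideanSpace.real_norm_sq_eq, hf]; norm_num
    simp [this, hn]
  obtain ⟨i, hi⟩ : ∃ i : Fin 3, n / 3 ≤ ∑ x, (f x i)^2 := by
    by_contra hc
    push Not at hc
    have : ∑ i : Fin 3, ∑ x, (f x i)^2 < ∑ i : Fin 3, n / 3 :=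
      Finset.sum_lt_sum_of_nonempty ⟨0, Finset.mem_univ _⟩ fun i _ => hc i
    rw [hsum] at this
    simp at this
    linarith
  let u : EuclideanSpace ℝ F := WithLp.toLp 2 fun x => f x i
  have hu : ∀ x, u x = f x i := fun x => rfl
  set s : ℝ := ∑ x, (f x i)^2 with hs
  have hun : ‖u‖^2 = s := by
    rw [EuclideanSpace.real_norm_sq_eq]
  have h1 := hray u
  rw [hun] at h1
  have h2 : inner ℝ u (Matrix.toEuclideanLin M u) = ∑ x, ∑ y, k x y * (u x * u y) := by
    rw [PiLp.inner_apply]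
    refine Finset.sum_congr rfl fun x _ => ?_
    rw [hTa]
    simp only [RCLike.inner_apply, conj_trivial]
    rw [Finset.sum_mul]
    refine Finset.sum_congr rfl fun y _ => ?_
    ring
  have h3 : ∑ x, ∑ y, (inner ℝ (f x) (f y) * (u x * u y) - δ * (|u x| * |u y|)) ≤
      ∑ x, ∑ y, k x y * (u x * u y) := by
    refine Finset.sum_le_sum fun x _ => Finset.sum_le_sum fun y _ => ?_
    have e1 : |(inner ℝ (f x) (f y) - k x y) * (u x * u y)| ≤ δ * (|u x| * |u y|) := by
      rw [abs_mul, abs_mul (u x), abs_sub_comm]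
      exact mul_le_mul_of_nonneg_right (hkf x y) (by positivity)
    have e2 := le_abs_self ((inner ℝ (f x) (f y) - k x y) * (u x * u y))
    nlinarith
  have h4 : ∑ x, ∑ y, (inner ℝ (f x) (f y) * (u x * u y) - δ * (|u x| * |u y|)) =
      ‖∑ x, u x • f x‖^2 - δ * (∑ x, |u x|)^2 := by
    rw [← real_inner_self_eq_norm_sq, sum_inner, sq (∑ x, |u x|), Finset.sum_mul_sum]
    simp only [inner_sum, Finset.sum_sub_distrib, Finset.mul_sum, inner_smul_left, inner_smul_right]
    congr 1
    refine Finset.sum_congr rfl fun x _ => Finset.sum_congr rfl fun y _ => ?_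
    simp
    ring
  have h5 : (∑ x, |u x|)^2 ≤ n * s := by
    have := sq_sum_le_card_mul_sum_sq (s := (Finset.univ : Finset F)) (f := fun x => |u x|)
    simpa [hs, hn, hu] using this
  have h6 : s ≤ ‖∑ x, u x • f x‖ := by
    have e1 : (∑ x, u x • f x) i = s := by
      simp [hs, hu, sq]
    have e2 := PiLp.norm_apply_le (∑ x, u x • f x) i
    rw [e1] at e2
    exact (le_abs_self s).trans e2
  have hs0 : 0 < s := by linarith [div_pos hnpos (by norm_num : (0:ℝ) < 3)]
  have hδ0 : 0 ≤ δ := by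
    obtain ⟨x⟩ := ‹Nonempty F›
    exact (abs_nonneg _).trans (hkf x x)
  have h7 : s^2 ≤ ‖∑ x, u x • f x‖^2 := by gcongr
  have h8 : s^2 - δ * (n * s) ≤ n / 4 * s := by
    have := mul_le_mul_of_nonneg_left h5 hδ0
    rw [h2] at h1
    linarith
  have h9 : s - δ * n ≤ n / 4 := by
    by_contra hc
    push Not at hc
    nlinarith
  nlinarith

/-- The space of eigenfunctions of the kernel `k` for `Λ`. -/
def eigV (k : F → F → ℝ) (Λ : ℝ) : Submodule ℝ (EuclideanSpace ℝ F) where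
  carrier := {u | ∀ x, ∑ y, k x y * u y = Λ * u x}
  zero_mem' := by intro x; simp
  add_mem' := by
    intro u v hu hv x
    simp only [PiLp.add_apply, mul_add, Finset.sum_add_distrib]
    rw [hu x, hv x]
  smul_mem' := by
    intro c u hu x
    simp only [PiLp.smul_apply, smul_eq_mul]
    have h := hu x
    have : ∑ y, k x y * (c * u y) = c * ∑ y, k x y * u y := by
      rw [Finset.mul_sum]
      exact Finset.sum_congr rfl fun y _ => by ring
    rw [this, h]; ring

/-- The vector representing the linear function approximating an eigenfunction. -/
noncomputable def wmap (f : F → E3) (Λ : ℝ) : EuclideanSpace ℝ F →ₗ[ℝ] E3 where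
  toFun u := Λ⁻¹ • ∑ y, u y • f y
  map_add' u v := by
    simp only [PiLp.add_apply, add_smul, Finset.sum_add_distrib, smul_add]
  map_smul' c u := by
    simp only [PiLp.smul_apply, smul_eq_mul, mul_smul, RingHom.id_apply]
    rw [← Finset.smul_sum, smul_comm]

lemma wmap_norm [Nonempty F] (f : F → E3) (hf : ∀ x, ‖f x‖ = 1) (Λ : ℝ)
    (hΛ : (Fintype.card F : ℝ) / 4 ≤ Λ)
    (u : EuclideanSpace ℝ F) (m : ℝ) (hm : ∀ x, |u x| ≤ m) : ‖wmap f Λ u‖ ≤ 4 * m := by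
  have hnpos : (0 : ℝ) < Fintype.card F := by exact_mod_cast Fintype.card_pos
  have hΛ0 : 0 < Λ := by linarith
  have hm0 : 0 ≤ m := by
    obtain ⟨x⟩ := ‹Nonempty F›
    exact (abs_nonneg _).trans (hm x)
  have h1 : ‖∑ y, u y • f y‖ ≤ Fintype.card F * m := by
    refine (norm_sum_le _ _).trans ?_
    have : ∀ y ∈ Finset.univ, ‖u y • f y‖ ≤ m := by
      intro y _
      rw [norm_smul, hf, mul_one]
      exact hm y
    simpa using Finset.sum_le_card_nsmul _ _ _ this
  change ‖Λ⁻¹ • ∑ y, u y • f y‖ ≤ 4 * m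
  rw [norm_smul, norm_inv, Real.norm_of_nonneg hΛ0.le, inv_mul_le_iff₀ hΛ0]
  nlinarith

lemma wmap_approx [Nonempty F] (k : F → F → ℝ) (f : F → E3) (δ : ℝ)
    (hkf : ∀ x y, |k x y - inner ℝ (f x) (f y)| ≤ δ) (Λ : ℝ)
    (hΛ : (Fintype.card F : ℝ) / 4 ≤ Λ)
    (u : EuclideanSpace ℝ F) (hu : u ∈ eigV k Λ) (m : ℝ) (hm : ∀ x, |u x| ≤ m) (x : F) :
    |u x - inner ℝ (f x) (wmap f Λ u)| ≤ 4 * δ * m := by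
  have hnpos : (0 : ℝ) < Fintype.card F := by exact_mod_cast Fintype.card_pos
  have hΛ0 : 0 < Λ := by linarith
  have hm0 : 0 ≤ m := (abs_nonneg _).trans (hm x)
  have hδ0 : 0 ≤ δ := (abs_nonneg _).trans (hkf x x)
  have h1 : u x = Λ⁻¹ * ∑ y, k x y * u y := by
    rw [hu x, inv_mul_cancel_left₀ hΛ0.ne']
  have h2 : inner ℝ (f x) (wmap f Λ u) = Λ⁻¹ * ∑ y, inner ℝ (f x) (f y) * u y := by
    change inner ℝ (f x) (Λ⁻¹ • ∑ y, u y • f y) = _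
    rw [inner_smul_right, inner_sum]
    congr 1
    refine Finset.sum_congr rfl fun y _ => ?_
    rw [inner_smul_right, mul_comm]
  have h3 : u x - inner ℝ (f x) (wmap f Λ u) =
      Λ⁻¹ * ∑ y, (k x y - inner ℝ (f x) (f y)) * u y := by
    rw [h2]
    nth_rewrite 1 [h1]
    rw [← mul_sub, ← Finset.sum_sub_distrib]
    simp only [sub_mul]
  rw [h3, abs_mul, abs_inv, abs_of_pos hΛ0, inv_mul_le_iff₀ hΛ0]
  have h4 : |∑ y, (k x y - inner ℝ (f x) (f y)) * u y| ≤ Fintype.card F * (δ * m) := by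
    refine (Finset.abs_sum_le_sum_abs _ _).trans ?_
    have : ∀ y ∈ Finset.univ, |(k x y - inner ℝ (f x) (f y)) * u y| ≤ δ * m := by
      intro y _
      rw [abs_mul]
      exact mul_le_mul (hkf x y) (hm y) (abs_nonneg _) hδ0
    simpa using Finset.sum_le_card_nsmul _ _ _ this
  have := mul_nonneg hδ0 hm0
  nlinarith

lemma exists_max [Nonempty F] (u : EuclideanSpace ℝ F) : ∃ y, ∀ x, |u x| ≤ |u y| := by
  obtain ⟨y, hy⟩ := Finite.exists_max fun x => |u x|
  exact ⟨y, hy⟩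

lemma finrank_eigV [Nonempty F] (k : F → F → ℝ) (f : F → E3) (δ : ℝ) (hδ : δ < 1/12)
    (hkf : ∀ x y, |k x y - inner ℝ (f x) (f y)| ≤ δ) (Λ : ℝ)
    (hΛ : (Fintype.card F : ℝ) / 4 ≤ Λ) : Module.finrank ℝ (eigV k Λ) ≤ 3 := by
  have hinj : Function.Injective ((wmap f Λ).comp (eigV k Λ).subtype) := by
    rw [← LinearMap.ker_eq_bot, LinearMap.ker_eq_bot']
    rintro ⟨u, hu⟩ h0
    have h0' : wmap f Λ u = 0 := h0
    obtain ⟨y, hy⟩ := exists_max u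
    have h1 := wmap_approx k f δ hkf Λ hΛ u hu _ hy y
    rw [h0', inner_zero_right, sub_zero] at h1
    have h2 : |u y| = 0 := by
      have := abs_nonneg (u y)
      nlinarith
    apply Subtype.ext
    ext x
    have := hy x
    rw [h2] at this
    exact abs_nonpos_iff.mp this
  have := LinearMap.finrank_le_finrank_of_injective hinj
  simpa using this

lemma no_small_invariant [Nonempty F] (k : F → F → ℝ) (f : F → E3)
    (hf : ∀ x, ‖f x‖ = 1) (δ : ℝ) (hδ : δ < 1/12)
    (hkf : ∀ x y, |k x y - inner ℝ (f x) (f y)| ≤ δ)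
    (hdense : ∀ p : E3, ‖p‖ = 1 → ∃ x, ‖f x - p‖ ≤ δ) (Λ : ℝ)
    (hΛ : (Fintype.card F : ℝ) / 4 ≤ Λ)
    (U : Submodule ℝ (EuclideanSpace ℝ F)) (hU : U ≤ eigV k Λ) (hU0 : U ≠ ⊥)
    (hU2 : Module.finrank ℝ U ≤ 2)
    (hinv : ∀ u ∈ U, ∀ x y, ∃ u' ∈ U, u' x = u y ∧ ∀ m, (∀ z, |u z| ≤ m) → ∀ z, |u' z| ≤ m) :
    False := by
  obtain ⟨u, hu, hu0⟩ := (Submodule.ne_bot_iff _).mp hU0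
  set P : Submodule ℝ E3 := U.map (wmap f Λ) with hP
  have hPr : Module.finrank ℝ P ≤ 2 := (Submodule.finrank_map_le _ _).trans hU2
  have hPo : Pᗮ ≠ ⊥ := by
    intro h
    have := P.finrank_add_finrank_orthogonal
    rw [h, finrank_bot, finrank_euclideanSpace, Fintype.card_fin] at this
    omega
  obtain ⟨q, hq, hq0⟩ := (Submodule.ne_bot_iff _).mp hPo
  set p : E3 := ‖q‖⁻¹ • q with hp
  have hpn : ‖p‖ = 1 := by
    rw [hp, norm_smul, norm_inv, norm_norm, inv_mul_cancel₀ (norm_ne_zero_iff.mpr hq0)]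
  have hpo : p ∈ Pᗮ := Submodule.smul_mem _ _ hq
  obtain ⟨x, hx⟩ := hdense p hpn
  obtain ⟨y, hy⟩ := exists_max u
  obtain ⟨u', hu', hu'x, hu'm⟩ := hinv u hu x y
  have hm := hu'm _ hy
  have h1 := wmap_approx k f δ hkf Λ hΛ u' (hU hu') _ hm x
  have h2 := wmap_norm f hf Λ hΛ u' _ hm
  have h3 : inner ℝ (f x) (wmap f Λ u') = inner ℝ (f x - p) (wmap f Λ u') := by
    rw [inner_sub_left]
    have : inner ℝ p (wmap f Λ u') = 0 :=
      (Submodule.mem_orthogonal' _ _).mp hpo _ (Submodule.mem_map_of_mem hu')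
    rw [this, sub_zero]
  have h4 := abs_real_inner_le_norm (f x - p) (wmap f Λ u')
  rw [h3, hu'x] at h1
  have hpos : 0 < |u y| := by
    rcases (abs_nonneg (u y)).eq_or_lt with h | h
    · exfalso
      apply hu0
      ext z
      have := hy z
      rw [← h] at this
      exact abs_nonpos_iff.mp this
    · exact h
  have hδ0 : 0 ≤ δ := (norm_nonneg _).trans hx
  have h5 : ‖f x - p‖ * ‖wmap f Λ u'‖ ≤ δ * (4 * |u y|) :=
    mul_le_mul hx h2 (norm_nonneg _) hδ0
  have h6 := abs_sub_abs_le_abs_sub (u y) (inner ℝ (f x - p) (wmap f Λ u'))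
  nlinarith

lemma exists_height (w : E3) (t : ℝ) (ht0 : 0 ≤ t) (ht1 : t ≤ 1) :
    ∃ p : E3, ‖p‖ = 1 ∧ inner ℝ p w = t * ‖w‖ := by
  have key : ∀ w : E3, ‖w‖ = 1 → ∃ p : E3, ‖p‖ = 1 ∧ inner ℝ p w = t := by
    intro w hw
    have hPo : (Submodule.span ℝ {w})ᗮ ≠ ⊥ := by
      intro h
      have h1 := (Submodule.span ℝ {w}).finrank_add_finrank_orthogonal
      have h2 := finrank_span_le_card (R := ℝ) ({w} : Set E3)
      rw [h, finrank_bot, finrank_euclideanSpace, Fintype.card_fin] at h1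
      simp at h2
      omega
    obtain ⟨q, hq, hq0⟩ := (Submodule.ne_bot_iff _).mp hPo
    set z : E3 := ‖q‖⁻¹ • q with hz
    have hzn : ‖z‖ = 1 := by
      rw [hz, norm_smul, norm_inv, norm_norm, inv_mul_cancel₀ (norm_ne_zero_iff.mpr hq0)]
    have hzw : inner ℝ z w = 0 :=
      (Submodule.mem_orthogonal' _ _).mp (Submodule.smul_mem _ _ hq) _
        (Submodule.mem_span_singleton_self w)
    refine ⟨t • w + Real.sqrt (1 - t^2) • z, ?_, ?_⟩
    · have hsq : ‖t • w + Real.sqrt (1 - t^2) • z‖^2 = 1 := by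
        rw [norm_add_sq_real, norm_smul, norm_smul, inner_smul_left, inner_smul_right,
          real_inner_comm, hzw, hw, hzn]
        simp only [mul_one, mul_zero, add_zero, Real.norm_eq_abs, sq_abs]
        rw [Real.sq_sqrt (by nlinarith)]
        ring
      have := norm_nonneg (t • w + Real.sqrt (1 - t^2) • z)
      nlinarith
    · rw [inner_add_left, inner_smul_left, inner_smul_left, hzw, real_inner_self_eq_norm_sq, hw]
      simp
  by_cases hw : w = 0
  · subst hw
    obtain ⟨p, hp, -⟩ := key (EuclideanSpace.single 0 1) (by simp)
    exact ⟨p, hp, by simp⟩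
  · have hw' : ‖w‖ ≠ 0 := norm_ne_zero_iff.mpr hw
    obtain ⟨p, hp, hpw⟩ := key (‖w‖⁻¹ • w) (by
      rw [norm_smul, norm_inv, norm_norm, inv_mul_cancel₀ hw'])
    refine ⟨p, hp, ?_⟩
    rw [inner_smul_right] at hpw
    field_simp at hpw
    linarith

lemma many_values [Nonempty F] (k : F → F → ℝ) (f : F → E3)
    (hf : ∀ x, ‖f x‖ = 1) (N : ℕ) (δ : ℝ) (hδ : δ < 1/(100 * (N + 1)))
    (hkf : ∀ x y, |k x y - inner ℝ (f x) (f y)| ≤ δ)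
    (hdense : ∀ p : E3, ‖p‖ = 1 → ∃ x, ‖f x - p‖ ≤ δ) (Λ : ℝ)
    (hΛ : (Fintype.card F : ℝ) / 4 ≤ Λ)
    (u : EuclideanSpace ℝ F) (hu : u ∈ eigV k Λ) (hu0 : u ≠ 0) :
    ∃ φ : Fin (N + 1) → F, Function.Injective fun i => u (φ i) := by
  obtain ⟨y, hy⟩ := exists_max u
  set m := |u y| with hm
  have hpos : 0 < m := by
    rcases (abs_nonneg (u y)).eq_or_lt with h | h
    · exfalso
      apply hu0
      ext z
      have := hy z
      rw [hm, ← h] at this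
      exact abs_nonpos_iff.mp this
    · exact h
  set w := wmap f Λ u with hw
  have happ := wmap_approx k f δ hkf Λ hΛ u hu _ hy
  have hwn := wmap_norm f hf Λ hΛ u _ hy
  have hN : (0 : ℝ) < N + 1 := by positivity
  have hδN : δ * (N + 1) < 1 / 100 := by
    rw [lt_div_iff₀ (by positivity)] at hδ
    linarith
  have hδ0 : 0 ≤ δ := (abs_nonneg _).trans (hkf y y)
  have hN1 : (0 : ℝ) ≤ N := by positivity
  have hδ1 : δ < 1 / 100 := by nlinarith
  have hwlow : m / 2 ≤ ‖w‖ := by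
    have h1 := happ y
    have h2 := abs_real_inner_le_norm (f y) w
    rw [hf, one_mul] at h2
    have h3 := abs_sub_abs_le_abs_sub (u y) (inner ℝ (f y) w)
    nlinarith
  have hex : ∀ i : Fin (N + 1), ∃ x, |u x - (i : ℝ) / (N + 1) * ‖w‖| ≤ 8 * δ * m := by
    intro i
    obtain ⟨p, hp, hpw⟩ := exists_height w ((i : ℝ) / (N + 1)) (by positivity) (by
      rw [div_le_one hN]
      have := i.2
      exact_mod_cast this.le)
    obtain ⟨x, hx⟩ := hdense p hp
    refine ⟨x, ?_⟩
    have h1 := happ x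
    have h2 : |inner ℝ (f x) w - inner ℝ p w| ≤ δ * (4 * m) := by
      rw [← inner_sub_left]
      exact (abs_real_inner_le_norm _ _).trans (mul_le_mul hx hwn (norm_nonneg _) hδ0)
    rw [← hpw]
    have := abs_sub_le (u x) (inner ℝ (f x) w) (inner ℝ p w)
    linarith
  choose φ hφ using hex
  refine ⟨φ, ?_⟩
  have hlt : ∀ i j : Fin (N + 1), i < j → u (φ i) ≠ u (φ j) := by
    intro i j hij h
    have h1 := abs_le.mp (hφ i)
    have h2 := abs_le.mp (hφ j)
    rw [h] at h1
    have h3 : (i : ℝ) + 1 ≤ (j : ℝ) := by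
      have : (i : ℕ) + 1 ≤ (j : ℕ) := hij
      exact_mod_cast this
    have h4 : (j : ℝ) / (N + 1) * ‖w‖ - (i : ℝ) / (N + 1) * ‖w‖ ≤ 16 * δ * m := by linarith
    have h5 : (j : ℝ) / (N + 1) * ‖w‖ - (i : ℝ) / (N + 1) * ‖w‖ = ((j : ℝ) - i) * ‖w‖ / (N + 1) := by
      field_simp
    rw [h5, div_le_iff₀ hN] at h4
    have h6 : ‖w‖ ≤ ((j : ℝ) - i) * ‖w‖ := by nlinarith [norm_nonneg w]
    nlinarith
  intro i j h
  rcases lt_trichotomy i j with hij | hij | hij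
  · exact absurd h (hlt i j hij)
  · exact hij
  · exact absurd h.symm (hlt j i hij)

end Spectral

section Action
variable {F : Type} [Fintype F] [MetricSpace F]

/-- The kernel on `F` which mimics the inner product. -/
noncomputable def ker (x y : F) : ℝ := 1 - dist x y ^ 2 / 2

lemma comp_mem (Λ : ℝ) (g : F ≃ᵢ F) (u : EuclideanSpace ℝ F) (hu : u ∈ eigV (ker (F := F)) Λ) :
    (WithLp.toLp 2 fun x => u (g x)) ∈ eigV (ker (F := F)) Λ := by
  intro x
  have h1 := hu (g x)
  change ∑ y, ker x y * u (g y) = Λ * u (g x)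
  rw [← h1, ← Equiv.sum_comp g.toEquiv fun y => ker (g x) y * u y]
  refine Finset.sum_congr rfl fun y _ => ?_
  have : ker (g x) (g.toEquiv y) = ker x y := by
    change 1 - dist (g x) (g y) ^ 2 / 2 = _
    rw [g.dist_eq]; rfl
  rw [this]
  rfl

/-- Precomposition with an isometry, on the eigenspace. -/
noncomputable def compIso (Λ : ℝ) (g : F ≃ᵢ F) :
    eigV (ker (F := F)) Λ →ₗᵢ[ℝ] eigV (ker (F := F)) Λ where
  toFun u := ⟨WithLp.toLp 2 fun x => u.1 (g x), comp_mem Λ g u.1 u.2⟩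
  map_add' u v := rfl
  map_smul' c u := rfl
  norm_map' u := by
    change ‖(WithLp.toLp 2 fun x => u.1 (g x) : EuclideanSpace ℝ F)‖ = ‖u.1‖
    rw [EuclideanSpace.norm_eq, EuclideanSpace.norm_eq]
    congr 1
    exact Equiv.sum_comp g.toEquiv fun x => ‖u.1 x‖ ^ 2

/-- The linear group induced on the eigenspace by the isometries of `F`. -/
noncomputable def linGroup (Λ : ℝ) (L : E3 ≃ₗᵢ[ℝ] eigV (ker (F := F)) Λ) :
    Subgroup (E3 ≃ₗᵢ[ℝ] E3) where
  carrier := {B | ∃ g : F ≃ᵢ F, ∀ a x, (L (B a)).1 x = (L a).1 (g x)}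
  one_mem' := ⟨1, fun a x => rfl⟩
  mul_mem' := by
    rintro A B ⟨g, hg⟩ ⟨h, hh⟩
    refine ⟨h * g, fun a x => ?_⟩
    change (L (A (B a))).1 x = (L a).1 (h (g x))
    rw [hg, hh]
  inv_mem' := by
    rintro A ⟨g, hg⟩
    refine ⟨g⁻¹, fun a x => ?_⟩
    have h1 := hg (A.symm a) (g.symm x)
    rw [A.apply_symm_apply, g.apply_symm_apply] at h1
    exact h1.symm

lemma linGroup_finite (Λ : ℝ) (L : E3 ≃ₗᵢ[ℝ] eigV (ker (F := F)) Λ) : Finite (linGroup Λ L) := by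
  have hp : ∀ B : linGroup Λ L, ∃ g : F ≃ᵢ F, ∀ a x, (L (B.1 a)).1 x = (L a).1 (g x) := fun B => B.2
  choose φ hφ using hp
  have : Finite (F ≃ᵢ F) := Finite.of_injective _ IsometryEquiv.toEquiv_injective
  refine Finite.of_injective φ ?_
  intro A B hAB
  apply Subtype.ext
  ext1 a
  apply L.injective
  apply Subtype.ext
  ext x
  rw [hφ A, hφ B, hAB]

lemma linGroup_exists (Λ : ℝ) (L : E3 ≃ₗᵢ[ℝ] eigV (ker (F := F)) Λ) (g : F ≃ᵢ F) :
    ∃ B ∈ linGroup Λ L, ∀ a x, (L (B a)).1 x = (L a).1 (g x) := by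
  let B : E3 ≃ₗᵢ[ℝ] E3 := (L.trans ((compIso Λ g).toLinearIsometryEquiv rfl)).trans L.symm
  have hB : ∀ a x, (L (B a)).1 x = (L a).1 (g x) := by
    intro a x
    have : L (B a) = compIso Λ g (L a) := by
      change L (L.symm _) = _
      rw [L.apply_symm_apply]
      rfl
    rw [this]
    rfl
  exact ⟨B, ⟨g, hB⟩, hB⟩

lemma main_contra [Nonempty F] (N : ℕ)
    (hN : ∀ (Γ : Subgroup (E3 ≃ₗᵢ[ℝ] E3)) [Finite Γ],
      Nat.card Γ ≤ N ∨ ∃ a : E3, a ≠ 0 ∧ ∀ B ∈ Γ, ∃ t : ℝ, B a = t • a)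
    (htrans : ∀ x y : F, ∃ φ : F ≃ᵢ F, φ x = y)
    (f : F → E3) (hf : ∀ x, ‖f x‖ = 1) (δ : ℝ) (hδ : δ < 1/(100 * (N + 1)))
    (hkf : ∀ x y, |ker x y - inner ℝ (f x) (f y)| ≤ δ)
    (hdense : ∀ p : E3, ‖p‖ = 1 → ∃ x, ‖f x - p‖ ≤ δ) : False := by
  have hδ1 : δ < 1/12 := by
    refine hδ.trans_le ?_
    have : (0 : ℝ) ≤ N := by positivity
    apply one_div_le_one_div_of_le <;> linarith
  obtain ⟨Λ, hΛ, u, hu0, hu⟩ := top_eigen ker (fun x y => by simp [ker, dist_comm]) f hf δ hδ1 hkf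
  have huV : u ∈ eigV (ker (F := F)) Λ := hu
  have hle := finrank_eigV ker f δ hδ1 hkf Λ hΛ
  have hVne : eigV (ker (F := F)) Λ ≠ ⊥ := fun h => hu0 (by rw [h] at huV; exact huV)
  have hge : ¬ Module.finrank ℝ (eigV (ker (F := F)) Λ) ≤ 2 := by
    intro h
    refine no_small_invariant ker f hf δ hδ1 hkf hdense Λ hΛ _ le_rfl hVne h ?_
    intro v hv x y
    obtain ⟨g, hg⟩ := htrans x y
    exact ⟨_, comp_mem Λ g v hv, by change v (g x) = v y; rw [hg], fun m hm z => hm (g z)⟩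
  have h3 : Module.finrank ℝ (eigV (ker (F := F)) Λ) = 3 := by omega
  let L : E3 ≃ₗᵢ[ℝ] eigV (ker (F := F)) Λ :=
    ((stdOrthonormalBasis ℝ (eigV (ker (F := F)) Λ)).reindex (finCongr h3)).repr.symm
  have := linGroup_finite Λ L
  rcases hN (linGroup Λ L) with hcard | ⟨a, ha0, ha⟩
  · obtain ⟨φ, hφ⟩ := many_values ker f hf N δ hδ hkf hdense Λ hΛ u huV hu0
    obtain ⟨x0⟩ := ‹Nonempty F›
    have hB : ∀ i, ∃ B : linGroup Λ L, (L (B.1 (L.symm ⟨u, huV⟩))).1 x0 = u (φ i) := by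
      intro i
      obtain ⟨g, hg⟩ := htrans x0 (φ i)
      obtain ⟨B, hB, hBg⟩ := linGroup_exists Λ L g
      refine ⟨⟨B, hB⟩, ?_⟩
      rw [hBg, L.apply_symm_apply, hg]
    choose ψ hψ using hB
    have hinj : Function.Injective ψ := by
      intro i j hij
      apply hφ
      change u (φ i) = u (φ j)
      rw [← hψ i, ← hψ j, hij]
    have := Nat.card_le_card_of_injective ψ hinj
    rw [Nat.card_fin] at this
    omega
  · refine no_small_invariant ker f hf δ hδ1 hkf hdense Λ hΛ (Submodule.span ℝ {(L a).1}) ?_ ?_ ?_ ?_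
    · rw [Submodule.span_singleton_le_iff_mem]
      exact (L a).2
    · rw [Ne, Submodule.span_singleton_eq_bot]
      intro h
      have : L a = 0 := Subtype.ext h
      exact ha0 (by simpa using this)
    · exact (finrank_span_le_card (R := ℝ) ({(L a).1} : Set (EuclideanSpace ℝ F))).trans (by simp)
    · intro v hv x y
      obtain ⟨c, rfl⟩ := Submodule.mem_span_singleton.mp hv
      obtain ⟨g, hg⟩ := htrans x y
      obtain ⟨B, hB, hBg⟩ := linGroup_exists Λ L g
      obtain ⟨t, ht⟩ := ha B hB
      have hval : ∀ z, (c • (t • (L a).1)) z = (c • (L a).1) (g z) := by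
        intro z
        have h1 := hBg a z
        rw [ht, map_smul] at h1
        change c * (t • (L a).1) z = c * (L a).1 (g z)
        rw [← h1]
        rfl
      refine ⟨c • (t • (L a).1), ?_, ?_, ?_⟩
      · exact Submodule.smul_mem _ _ (Submodule.smul_mem _ _ (Submodule.mem_span_singleton_self _))
      · rw [hval, hg]
      · intro m hm z
        rw [hval]
        exact hm (g z)

end Action

/-- `S²` cannot be approximated by finite homogeneous (transitive) metric spaces. -/
theorem sphere_not_approximable_by_finite_transitive_spaces :
    ∃ ε > (0 : ℝ), ∀ (F : Type) [MetricSpace F] [Finite F] [Nonempty F],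
      (∀ x y : F, ∃ φ : F ≃ᵢ F, φ x = y) →
      ε ≤ GromovHausdorff.ghDist twoSphere F := by
  obtain ⟨N, hN⟩ := jordan_bound
  set ε : ℝ := 1 / (1000 * (N + 1)) with hε
  have hε0 : 0 < ε := by positivity
  have hε1 : ε ≤ 1 / 1000 := by
    have : (0 : ℝ) ≤ N := by positivity
    apply one_div_le_one_div_of_le <;> linarith
  refine ⟨ε, hε0, ?_⟩
  intro F _ _ _ htrans
  have := Fintype.ofFinite F
  by_contra hlt
  push Not at hlt
  obtain ⟨Φ, Ψ, hΦ, hΨ, hd⟩ := GromovHausdorff.ghDist_eq_hausdorffDist twoSphere F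
  rw [hd] at hlt
  have hfin : Metric.hausdorffEDist (Set.range Φ) (Set.range Ψ) ≠ ⊤ :=
    Metric.hausdorffEDist_ne_top_of_nonempty_of_bounded (Set.range_nonempty _)
      (Set.range_nonempty _) (isCompact_range hΦ.continuous).isBounded
      (isCompact_range hΨ.continuous).isBounded
  have h1 : ∀ y : F, ∃ x : twoSphere, dist (Φ x) (Ψ y) < ε := by
    intro y
    obtain ⟨_, ⟨x, rfl⟩, hx⟩ :=
      Metric.exists_dist_lt_of_hausdorffDist_lt' (Set.mem_range_self y) hlt hfin
    exact ⟨x, hx⟩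
  have h2 : ∀ x : twoSphere, ∃ y : F, dist (Φ x) (Ψ y) < ε := by
    intro x
    obtain ⟨_, ⟨y, rfl⟩, hy⟩ :=
      Metric.exists_dist_lt_of_hausdorffDist_lt (Set.mem_range_self x) hlt hfin
    exact ⟨y, hy⟩
  choose f hf using h1
  have hnorm : ∀ x : twoSphere, ‖(x : E3)‖ = 1 := fun x => by simpa using x.2
  refine main_contra N hN htrans (fun y => (f y : E3)) (fun y => hnorm _) (6 * ε) ?_ ?_ ?_
  · rw [hε, lt_div_iff₀ (by positivity)]
    field_simp
    norm_num
  · intro x y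
    have e1 : dist (f x) (f y) ≤ dist x y + 2 * ε := by
      rw [← hΦ.dist_eq, ← hΨ.dist_eq x y]
      have := dist_triangle4 (Φ (f x)) (Ψ x) (Ψ y) (Φ (f y))
      have a1 := hf x
      have a2 := hf y
      rw [dist_comm] at a2
      linarith
    have e2 : dist x y ≤ dist (f x) (f y) + 2 * ε := by
      rw [← hΦ.dist_eq, ← hΨ.dist_eq x y]
      have := dist_triangle4 (Ψ x) (Φ (f x)) (Φ (f y)) (Ψ y)
      have a1 := hf x
      have a2 := hf y
      rw [dist_comm] at a1
      linarith
    have e3 : inner ℝ (f x : E3) (f y : E3) = 1 - dist (f x) (f y) ^ 2 / 2 := by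
      have := norm_sub_sq_real (f x : E3) (f y : E3)
      rw [hnorm, hnorm, ← dist_eq_norm] at this
      change dist (f x) (f y) ^ 2 = _ at this
      linarith
    have e4 : dist (f x) (f y) ≤ 2 := by
      change dist (f x : E3) (f y : E3) ≤ 2
      rw [dist_eq_norm]
      have := norm_sub_le (f x : E3) (f y : E3)
      rw [hnorm, hnorm] at this
      linarith
    have e5 : 0 ≤ dist (f x) (f y) := dist_nonneg
    have e6 : 0 ≤ dist x y := dist_nonneg
    rw [e3, ker, abs_le]
    constructor <;> nlinarith
  · intro p hp
    obtain ⟨y, hy⟩ := h2 ⟨p, by simpa using hp⟩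
    refine ⟨y, ?_⟩
    rw [← dist_eq_norm]
    change dist (f y) (⟨p, by simpa using hp⟩ : twoSphere) ≤ 6 * ε
    rw [← hΦ.dist_eq]
    have := dist_triangle_right (Φ (f y)) (Φ ⟨p, by simpa using hp⟩) (Ψ y)
    have := hf y
    linarith
end

section
/- Let n ≥ 1 and let S be a set of polynomials in n variables with rational coefficients. Let Z = {x ∈ ℝⁿ : p(x) = 0 for all p ∈ S} be the common real zero set (evaluating via the inclusion ℚ ⊆ ℝ). Then the set of points x ∈ Z all of whose coordinates x_1, …, x_n are algebraic over ℚ is dense in Z with respect to the Euclidean topology. -/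
open Polynomial in
/-- A simple root of a real polynomial is accompanied by a sign change. -/
lemma aux_sign_change (f : ℝ[X]) (t : ℝ) (h0 : f.eval t = 0) (h1 : f.derivative.eval t ≠ 0)
    (ε : ℝ) (hε : 0 < ε) :
    ∃ a b : ℝ, t - ε < a ∧ a < b ∧ b < t + ε ∧ f.eval a * f.eval b < 0 := by
  obtain ⟨q, rfl⟩ := Polynomial.dvd_iff_isRoot.mpr h0
  have hq : q.eval t ≠ 0 := by simpa using h1
  have hpos : 0 < q.eval t * q.eval t := mul_self_pos.mpr hq
  have hc : Filter.Tendsto (fun z : ℝ => q.eval t * q.eval z) (nhds t)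
      (nhds (q.eval t * q.eval t)) := by
    have : Continuous (fun z : ℝ => q.eval t * q.eval z) := by fun_prop
    exact this.tendsto t
  obtain ⟨δ, hδ, H⟩ := Metric.eventually_nhds_iff.mp (hc.eventually (lt_mem_nhds hpos))
  set r := min δ ε / 2 with hr
  have hm : 0 < min δ ε := lt_min hδ hε
  have hr0 : 0 < r := by positivity
  have hrδ : r < δ := by have := min_le_left δ ε; linarith
  have hrε : r < ε := by have := min_le_right δ ε; linarith
  refine ⟨t - r, t + r, by linarith, by linarith, by linarith, ?_⟩
  have ha := @H (t - r) (by rw [Real.dist_eq]; simpa [abs_of_pos hr0] using hrδ)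
  have hb := @H (t + r) (by rw [Real.dist_eq]; simpa [abs_of_pos hr0] using hrδ)
  have hab : 0 < q.eval (t - r) * q.eval (t + r) := by
    have h2 := mul_pos ha hb
    have : q.eval t * q.eval (t - r) * (q.eval t * q.eval (t + r))
        = (q.eval t * q.eval t) * (q.eval (t - r) * q.eval (t + r)) := by ring
    rw [this] at h2
    exact (mul_pos_iff_of_pos_left hpos).mp h2
  have : ((X - C t) * q).eval (t - r) * ((X - C t) * q).eval (t + r)
      = - (r * r * (q.eval (t - r) * q.eval (t + r))) := by
    simp; ring
  rw [this]
  have := mul_pos (mul_pos hr0 hr0) hab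
  linarith

open Polynomial in
/-- A root of a nonzero polynomial with algebraic coefficients is algebraic. -/
lemma aux_algebraic_root (f : ℝ[X]) (hf : f ≠ 0) (hc : ∀ i, IsAlgebraic ℚ (f.coeff i))
    (s : ℝ) (hs : f.eval s = 0) : IsAlgebraic ℚ s := by
  have hl : f ∈ Polynomial.lifts (algebraMap (algebraicClosure ℚ ℝ) ℝ) := by
    rw [Polynomial.lifts_iff_coeff_lifts]
    intro i
    exact ⟨⟨f.coeff i, mem_algebraicClosure_iff.2 (hc i)⟩, rfl⟩
  obtain ⟨g, rfl⟩ := (Polynomial.mem_lifts _).mp hl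
  have : IsAlgebraic (algebraicClosure ℚ ℝ) s := by
    refine ⟨g, ?_, ?_⟩
    · rintro rfl; simp at hf
    · rwa [Polynomial.eval_map_algebraMap] at hs
  have : Algebra.IsAlgebraic ℚ (algebraicClosure ℚ ℝ) := algebraicClosure.isAlgebraic ℚ ℝ
  exact IsAlgebraic.restrictScalars ℚ ‹IsAlgebraic (algebraicClosure ℚ ℝ) s›

lemma aux_aeval_algebraic {n : ℕ} (y : Fin n → ℝ) (hy : ∀ i, IsAlgebraic ℚ (y i))
    (p : MvPolynomial (Fin n) ℚ) : IsAlgebraic ℚ (MvPolynomial.aeval y p) := by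
  induction p using MvPolynomial.induction_on with
  | C a => simpa using isAlgebraic_algebraMap (R := ℚ) (A := ℝ) a
  | add p q hp hq => rw [map_add]; exact hp.add hq
  | mul_X p i hp => rw [map_mul, MvPolynomial.aeval_X]; exact hp.mul (hy i)

lemma aux_aeval_cons {n : ℕ} (y : Fin n → ℝ) (s : ℝ) (p : MvPolynomial (Fin (n + 1)) ℚ) :
    MvPolynomial.aeval (Fin.cons s y : Fin (n + 1) → ℝ) p =
      ((MvPolynomial.finSuccEquiv ℚ n p).map (MvPolynomial.aeval y).toRingHom).eval s := by
  induction p using MvPolynomial.induction_on with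
  | C a => simp [MvPolynomial.finSuccEquiv_apply]
  | add p q hp hq => simp only [map_add, hp, hq, Polynomial.map_add, Polynomial.eval_add]
  | mul_X p i hp =>
    simp only [map_mul, hp, Polynomial.map_mul, Polynomial.eval_mul]
    congr 1
    refine Fin.cases ?_ (fun j => ?_) i
    · simp [MvPolynomial.finSuccEquiv_X_zero]
    · simp [MvPolynomial.finSuccEquiv_X_succ]

lemma aux_continuous {n : ℕ} (p : MvPolynomial (Fin n) ℚ) :
    Continuous (fun y : Fin n → ℝ => MvPolynomial.aeval y p) := by
  induction p using MvPolynomial.induction_on with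
  | C a => simpa using continuous_const
  | add p q hp hq => simp only [map_add]; exact hp.add hq
  | mul_X p i hp =>
    simp only [map_mul, MvPolynomial.aeval_X]
    exact hp.mul (continuous_apply i)

lemma aux_continuous_eval {n : ℕ} (g : Polynomial (MvPolynomial (Fin n) ℚ)) (a : ℝ) :
    Continuous (fun y : Fin n → ℝ => (g.map (MvPolynomial.aeval y).toRingHom).eval a) := by
  simp only [Polynomial.eval_map, Polynomial.eval₂_eq_sum_range]
  refine continuous_finsetSum _ fun i _ => ?_
  exact (aux_continuous (g.coeff i)).mul continuous_const

open Polynomial in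
/-- Pseudo-division argument: if `g` has minimal degree among the polynomials vanishing at `t`
after specialisation by `φ` (but not identically), then any specialisation `ψ` killing `ker φ`
and not killing the leading coefficient extends by sending `t` to any root of `g`. -/
lemma aux_pseudo {R : Type*} [CommRing R] [IsDomain R] (φ ψ : R →+* ℝ)
    (hker : ∀ r, φ r = 0 → ψ r = 0) (t s : ℝ) (g : R[X]) (hg0 : g ≠ 0)
    (hgt : (g.map φ).eval t = 0) (hgs : (g.map ψ).eval s = 0)
    (hmin : ∀ h : R[X], h.degree < g.degree → (h.map φ).eval t = 0 → h.map φ = 0)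
    (hlc : ψ g.leadingCoeff ≠ 0) :
    ∀ (N : ℕ) (h : R[X]), h.degree < N → (h.map φ).eval t = 0 → (h.map ψ).eval s = 0 := by
  intro N
  induction N with
  | zero =>
    intro h hd _
    have : h = 0 := by
      by_contra h0
      rw [degree_eq_natDegree h0] at hd
      exact absurd (Nat.cast_lt.mp hd) (Nat.not_lt_zero _)
    simp [this]
  | succ N ih =>
    intro h hd ht
    by_cases hlt : h.degree < g.degree
    · have h0 := hmin h hlt ht
      have : h.map ψ = 0 := by
        ext i
        rw [coeff_map, coeff_zero]
        apply hker
        rw [← coeff_map, h0, coeff_zero]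
      simp [this]
    · have hle : g.degree ≤ h.degree := not_lt.mp hlt
      have hh0 : h ≠ 0 := by
        rintro rfl
        rw [degree_zero, le_bot_iff, degree_eq_bot] at hle
        exact hg0 hle
      have hle' : g.natDegree ≤ h.natDegree := natDegree_le_natDegree hle
      have hgl : g.leadingCoeff ≠ 0 := leadingCoeff_ne_zero.mpr hg0
      have hhl : h.leadingCoeff ≠ 0 := leadingCoeff_ne_zero.mpr hh0
      set u : R[X] := C g.leadingCoeff * h with hu
      set v : R[X] := C h.leadingCoeff * X ^ (h.natDegree - g.natDegree) * g with hv
      have hdu : u.degree = h.degree := by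
        rw [hu, degree_mul, degree_C hgl, zero_add]
      have hdv : v.degree = h.degree := by
        rw [hv, degree_mul, degree_C_mul_X_pow _ hhl, degree_eq_natDegree hg0,
          degree_eq_natDegree hh0, ← Nat.cast_add, Nat.sub_add_cancel hle']
      have hu0 : u ≠ 0 := mul_ne_zero (C_ne_zero.mpr hgl) hh0
      have hlt' : (u - v).degree < u.degree := by
        apply degree_sub_lt_left (hdu.trans hdv.symm) hu0
        rw [hu, hv, leadingCoeff_mul, leadingCoeff_mul, leadingCoeff_mul, leadingCoeff_C,
          leadingCoeff_C, leadingCoeff_X_pow, mul_one, mul_comm]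
      have hd1 : (u - v).degree < N := by
        rw [hdu] at hlt'
        refine lt_of_lt_of_le hlt' ?_
        rw [degree_eq_natDegree hh0] at hd ⊢
        exact_mod_cast Nat.lt_succ_iff.mp (Nat.cast_lt.mp hd)
      have := ih (u - v) hd1 (by simp [hu, hv, ht, hgt])
      simp only [hu, hv, Polynomial.map_sub, Polynomial.map_mul, eval_sub, eval_mul, hgs,
        mul_zero, sub_zero, map_C, eval_C] at this
      exact (mul_eq_zero.mp this).resolve_left hlc

open Polynomial in
lemma aux_main (n : ℕ) (x : Fin n → ℝ) :
    ∃ᶠ y in nhds x, (∀ i, IsAlgebraic ℚ (y i)) ∧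
      ∀ p : MvPolynomial (Fin n) ℚ, MvPolynomial.aeval x p = 0 → MvPolynomial.aeval y p = 0 := by
  induction n with
  | zero =>
    apply Filter.Eventually.frequently
    refine Filter.Eventually.of_forall fun y => ⟨fun i => i.elim0, fun p hp => ?_⟩
    rwa [Subsingleton.elim y x]
  | succ n ih =>
    obtain ⟨t, x, rfl⟩ : ∃ (t : ℝ) (x' : Fin n → ℝ), x = Fin.cons t x' :=
      ⟨x 0, Fin.tail x, (Fin.cons_self_tail x).symm⟩
    have ih := ih x
    rw [Filter.frequently_iff]
    intro U hU
    have hcons : Continuous (fun z : ℝ × (Fin n → ℝ) => (Fin.cons z.1 z.2 : Fin (n + 1) → ℝ)) := by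
      refine continuous_pi fun i => ?_
      refine Fin.cases ?_ (fun j => ?_) i
      · simpa using continuous_fst
      · simp only [Fin.cons_succ]; fun_prop
    have hU' : (fun z : ℝ × (Fin n → ℝ) => (Fin.cons z.1 z.2 : Fin (n + 1) → ℝ)) ⁻¹' U
        ∈ nhds (t, x) := hcons.continuousAt.preimage_mem_nhds hU
    rw [nhds_prod_eq, Filter.mem_prod_iff] at hU'
    obtain ⟨A, hA, B, hB, hAB⟩ := hU'
    obtain ⟨ε, hε, hεA⟩ := Metric.mem_nhds_iff.mp hA
    -- it suffices to produce the new coordinate together with the old point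
    suffices H : ∃ y ∈ B, ∃ s : ℝ, |s - t| < ε ∧ (∀ i, IsAlgebraic ℚ (y i)) ∧ IsAlgebraic ℚ s ∧
        ∀ h : (MvPolynomial (Fin n) ℚ)[X],
          (h.map (MvPolynomial.aeval x).toRingHom).eval t = 0 →
          (h.map (MvPolynomial.aeval y).toRingHom).eval s = 0 by
      obtain ⟨y, hy, s, hs, hya, hsa, hh⟩ := H
      refine ⟨Fin.cons s y, ?_, ?_, ?_⟩
      · have hmem : (s, y) ∈ A ×ˢ B := ⟨hεA (by rwa [Metric.mem_ball, Real.dist_eq]), hy⟩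
        exact hAB hmem
      · intro i
        refine Fin.cases ?_ (fun j => ?_) i
        · simpa using hsa
        · simpa using hya j
      · intro p hp
        rw [aux_aeval_cons] at hp ⊢
        exact hh _ hp
    by_cases hcase : ∃ g : (MvPolynomial (Fin n) ℚ)[X],
        (g.map (MvPolynomial.aeval x).toRingHom).eval t = 0 ∧
        g.map (MvPolynomial.aeval x).toRingHom ≠ 0
    · -- minimal degree choice
      have hwf : ∃ g : (MvPolynomial (Fin n) ℚ)[X],
          ((g.map (MvPolynomial.aeval x).toRingHom).eval t = 0 ∧
            g.map (MvPolynomial.aeval x).toRingHom ≠ 0) ∧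
          ∀ h : (MvPolynomial (Fin n) ℚ)[X], h.degree < g.degree →
            (h.map (MvPolynomial.aeval x).toRingHom).eval t = 0 →
            h.map (MvPolynomial.aeval x).toRingHom = 0 := by
        let T : Set (MvPolynomial (Fin n) ℚ)[X] :=
          {g | (g.map (MvPolynomial.aeval x).toRingHom).eval t = 0 ∧
            g.map (MvPolynomial.aeval x).toRingHom ≠ 0}
        have hwf : WellFounded fun p q : (MvPolynomial (Fin n) ℚ)[X] => p.degree < q.degree :=
          Polynomial.degree_lt_wf
        obtain ⟨g, hg, hgm⟩ := hwf.has_min T hcase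
        refine ⟨g, hg, fun h hd ht => ?_⟩
        by_contra hne
        exact hgm h ⟨ht, hne⟩ hd
      obtain ⟨g, ⟨hgt, hgne⟩, hmin⟩ := hwf
      have hg0 : g ≠ 0 := by rintro rfl; simp at hgne
      have hlc : (MvPolynomial.aeval x).toRingHom g.leadingCoeff ≠ 0 := by
        intro hl
        have he : g.eraseLead.map (MvPolynomial.aeval x).toRingHom
            = g.map (MvPolynomial.aeval x).toRingHom := by
          conv_rhs => rw [← eraseLead_add_C_mul_X_pow g]
          rw [Polynomial.map_add, Polynomial.map_mul, map_C, hl]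
          simp
        apply hgne
        rw [← he]
        exact hmin _ (degree_eraseLead_lt hg0) (by rw [he]; exact hgt)
      have hder : (g.map (MvPolynomial.aeval x).toRingHom).derivative.eval t ≠ 0 := by
        intro hd
        rw [derivative_map] at hd
        have h0 := hmin _ (degree_derivative_lt hg0) hd
        rw [← derivative_map] at h0
        have hC := eq_C_of_derivative_eq_zero h0
        rw [hC, eval_C] at hgt
        rw [hgt, C_0] at hC
        exact hgne hC
      obtain ⟨a, b, ha, hab, hb, hsgn⟩ := aux_sign_change _ t hgt hder ε hε
      have ev1 : ∀ᶠ y in nhds x, (g.map (MvPolynomial.aeval y).toRingHom).eval a *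
          (g.map (MvPolynomial.aeval y).toRingHom).eval b < 0 :=
        (((aux_continuous_eval g a).mul (aux_continuous_eval g b)).tendsto x).eventually
          (gt_mem_nhds hsgn)
      have ev2 : ∀ᶠ y in nhds x, MvPolynomial.aeval y g.leadingCoeff ≠ 0 :=
        ((aux_continuous g.leadingCoeff).tendsto x).eventually (isOpen_ne.mem_nhds hlc)
      obtain ⟨y, ⟨hya, hyp⟩, hy1, hy2, hyB⟩ :=
        (ih.and_eventually (ev1.and (ev2.and hB))).exists
      obtain ⟨s, hs, hs0⟩ : ∃ s ∈ Set.Icc a b,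
          (g.map (MvPolynomial.aeval y).toRingHom).eval s = 0 := by
        have hc : ContinuousOn (fun z => (g.map (MvPolynomial.aeval y).toRingHom).eval z)
          (Set.Icc a b) := (Polynomial.continuous _).continuousOn
        rcases mul_neg_iff.mp hy1 with ⟨h1, h2⟩ | ⟨h1, h2⟩
        · exact intermediate_value_Icc' hab.le hc ⟨h2.le, h1.le⟩
        · exact intermediate_value_Icc hab.le hc ⟨h1.le, h2.le⟩
      refine ⟨y, hyB, s, ?_, hya, ?_, ?_⟩
      · rw [abs_lt]; constructor <;> linarith [hs.1, hs.2]
      · refine aux_algebraic_root _ ?_ ?_ s hs0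
        · intro h0
          apply hy2
          have := congrArg (fun q => q.coeff g.natDegree) h0
          simpa using this
        · intro i
          rw [coeff_map]
          exact aux_aeval_algebraic y hya _
      · intro h ht
        refine aux_pseudo (MvPolynomial.aeval x).toRingHom (MvPolynomial.aeval y).toRingHom
          hyp t s g hg0 hgt hs0 hmin hy2 (h.natDegree + 1) h ?_ ht
        exact lt_of_le_of_lt degree_le_natDegree (by exact_mod_cast Nat.lt_succ_self _)
    · push Not at hcase
      obtain ⟨y, ⟨hya, hyp⟩, hyB⟩ := (ih.and_eventually hB).exists
      obtain ⟨q, hq1, hq2⟩ := exists_rat_btwn (show t < t + ε by linarith)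
      refine ⟨y, hyB, q, ?_, hya, ?_, ?_⟩
      · rw [abs_lt]; constructor <;> linarith
      · exact isAlgebraic_algebraMap (R := ℚ) (A := ℝ) q
      · intro h ht
        have h0 := hcase h ht
        have : h.map (MvPolynomial.aeval y).toRingHom = 0 := by
          ext i
          rw [coeff_map, coeff_zero]
          apply hyp
          have := congrArg (fun q => q.coeff i) h0
          simpa using this
        rw [this, eval_zero]

/-- Algebraic points are dense in the real zero set of any family of rational polynomials:
every point of the common real zero set `Z` of a set of polynomials with rational
coefficients is in the closure of the points of `Z` with all coordinates algebraic. -/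
theorem algebraic_points_dense_in_rational_variety (n : ℕ) (hn : 1 ≤ n)
    (S : Set (MvPolynomial (Fin n) ℚ)) :
    {x : EuclideanSpace ℝ (Fin n) | ∀ p ∈ S, MvPolynomial.aeval x p = 0} ⊆
      closure {x : EuclideanSpace ℝ (Fin n) |
        (∀ p ∈ S, MvPolynomial.aeval x p = 0) ∧ ∀ i, IsAlgebraic ℚ (x i)} := by
  intro x hx
  rw [mem_closure_iff_frequently]
  have hc : Filter.Tendsto (fun y : Fin n → ℝ => (WithLp.toLp 2 y : EuclideanSpace ℝ (Fin n)))
      (nhds (x : Fin n → ℝ)) (nhds x) :=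
    (PiLp.continuous_toLp 2 (fun _ : Fin n => ℝ)).tendsto (x : Fin n → ℝ)
  refine hc.frequently ((aux_main n x).mono ?_)
  rintro y ⟨hy, hp⟩
  exact ⟨fun p hpS => hp p (hx p hpS), hy⟩
end
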